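/- Suppose that for each edge (i,j) ∈ E the rule X^S_{ij} is cap-monotone and buyer-monotone. Fix a report profile (v, c) and an edge (i,j) with (i,j) ∈ M*(v, c). For a bid b of buyer i, write κ(b) := c̄_ij((b, v_{-i}), c_{-j}). Define W_BT := {b ∈ ℝ : X^S_{ij}(κ(v_i), b, c_j) = 1} and W_MA := {b ∈ ℝ : buyer i trades with seller j in MA(S) at the profile ((b, v_{-i}), c)}. Suppose X^S_{ij}(κ(v_i), v_i, c_j) = 1 (so trade occurs). Then every b < inf W_BT satisfies b ∉ W_MA; hence p_MA := inf W_MA ≥ p_BT := inf W_BT (infima in ℝ ∪ {−∞,+∞}), p_MA is real with c_j ≤ κ(v_i) and p_MA ≤ v_i, and the seller's realized profit satisfies p_MA − c_j ≥ p_BT − c_j (in the extended reals). -/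

import Mathlib

open Finset

noncomputable section

/-- The weight of a set of buyer–seller edges `M` under buyer bids `b` and seller bids `s`:
`∑_{(i,j)∈M} (b i − s j)`. -/
def matchWeight {m n : ℕ} (b : Fin m → ℝ) (s : Fin n → ℝ)
    (M : Finset (Fin m × Fin n)) : ℝ :=
  ∑ e ∈ M, (b e.1 - s e.2)

/-- A set of edges is a matching: no two distinct edges share a buyer or share a seller. -/
def IsMatching {m n : ℕ} (M : Finset (Fin m × Fin n)) : Prop :=
  ∀ e ∈ M, ∀ e' ∈ M, e ≠ e' → e.1 ≠ e'.1 ∧ e.2 ≠ e'.2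

/-- A two-sided matching market with `m` buyers and `n` sellers: a finite edge set `E`,
a nonempty downward-closed family `Fam` of matchings contained in `E`, a fixed strict
linear tie-breaking order `tb` on `Fam`, and the selection `Mstar b s` of the `tb`-least
maximum-weight member of `Fam`. -/
structure MarketSetup (m n : ℕ) where
  E : Finset (Fin m × Fin n)
  Fam : Finset (Finset (Fin m × Fin n))
  tb : Finset (Fin m × Fin n) → Finset (Fin m × Fin n) → Prop
  Mstar : (Fin m → ℝ) → (Fin n → ℝ) → Finset (Fin m × Fin n)
  empty_mem : ∅ ∈ Fam
  subset_E : ∀ M ∈ Fam, M ⊆ E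
  matching : ∀ M ∈ Fam, IsMatching M
  downward_closed : ∀ M ∈ Fam, ∀ M' ⊆ M, M' ∈ Fam
  tb_irrefl : ∀ M ∈ Fam, ¬ tb M M
  tb_trans : ∀ M₁ ∈ Fam, ∀ M₂ ∈ Fam, ∀ M₃ ∈ Fam, tb M₁ M₂ → tb M₂ M₃ → tb M₁ M₃
  tb_total : ∀ M₁ ∈ Fam, ∀ M₂ ∈ Fam, M₁ ≠ M₂ → tb M₁ M₂ ∨ tb M₂ M₁
  Mstar_mem : ∀ b s, Mstar b s ∈ Fam
  Mstar_max : ∀ b s, ∀ M ∈ Fam, matchWeight b s M ≤ matchWeight b s (Mstar b s)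
  Mstar_lt : ∀ b s, ∀ M ∈ Fam,
      matchWeight b s M = matchWeight b s (Mstar b s) → M ≠ Mstar b s →
      tb (Mstar b s) M

/-- The set of costs `c` of seller `j` for which `(i,j)` lies in the maximum-weight
matching `M*(b, (c, s₋ⱼ))`. -/
def critSet {m n : ℕ} (mk : MarketSetup m n) (i : Fin m) (j : Fin n)
    (b : Fin m → ℝ) (s : Fin n → ℝ) : Set ℝ :=
  {c : ℝ | (i, j) ∈ mk.Mstar b (Function.update s j c)}

/-- The critical cost `c̄_ij(b, s₋ⱼ) = sup {c ∈ ℝ : (i,j) ∈ M*(b, (c, s₋ⱼ))}`,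
taken in the extended reals, with `sup ∅ = −∞`. -/
def critCost {m n : ℕ} (mk : MarketSetup m n) (i : Fin m) (j : Fin n)
    (b : Fin m → ℝ) (s : Fin n → ℝ) : EReal :=
  sSup ((fun x : ℝ => (x : EReal)) '' critSet mk i j b s)

/-- A cap-parameterized bilateral-trade allocation rule: `X κ b c = true` iff trade
occurs when the censoring cap is `κ`, the buyer's bid is `b`, and the seller's
reported cost is `c`. -/
def BTRule := EReal → ℝ → ℝ → Bool

/-- Buyer-monotonicity (DSIC-B): if trade occurs at bid `b` it also occurs at any higher bid. -/
def BuyerMonotone (X : BTRule) : Prop :=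
  ∀ (κ : EReal) (b b' c : ℝ), b ≤ b' → X κ b c = true → X κ b' c = true

/-- Seller-monotonicity (DSIC-S): if trade occurs at cost `c` it also occurs at any lower cost. -/
def SellerMonotone (X : BTRule) : Prop :=
  ∀ (κ : EReal) (b c c' : ℝ), c' ≤ c → X κ b c = true → X κ b c' = true

/-- Cap-monotonicity: if trade occurs under cap `κ₁` it also occurs under any larger cap `κ₂`. -/
def CapMonotone (X : BTRule) : Prop :=
  ∀ (κ₁ κ₂ : EReal) (b c : ℝ), κ₁ ≤ κ₂ → X κ₁ b c = true → X κ₂ b c = true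

/-- Buyer-run Meta-Auction allocation MA(B): at report profile `(v,s)`, seller `j`
trades with buyer `i` iff `(i,j) ∈ M*(v,s)` and the bilateral rule for the edge
trades under the cap `c̄_ij(v, s₋ⱼ)` with buyer bid `vᵢ` and seller cost `sⱼ`. -/
def tradesMAB {m n : ℕ} (mk : MarketSetup m n)
    (XB : Fin m × Fin n → BTRule)
    (v : Fin m → ℝ) (s : Fin n → ℝ) (i : Fin m) (j : Fin n) : Prop :=
  (i, j) ∈ mk.Mstar v s ∧
    XB (i, j) (critCost mk i j v s) (v i) (s j) = true

/-- Seller-run Meta-Auction allocation MA(S): at report profile `(b,c)`, buyer `i`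
trades with seller `j` iff `(i,j) ∈ M*(b,c)` and the bilateral rule for the edge
trades under the cap `c̄_ij(b, c₋ⱼ)` with buyer bid `bᵢ` and seller cost `cⱼ`. -/
def tradesMAS {m n : ℕ} (mk : MarketSetup m n)
    (XS : Fin m × Fin n → BTRule)
    (b : Fin m → ℝ) (c : Fin n → ℝ) (i : Fin m) (j : Fin n) : Prop :=
  (i, j) ∈ mk.Mstar b c ∧
    XS (i, j) (critCost mk i j b c) (b i) (c j) = true

/-- Replacing the bid of buyer `i` by `x` shifts the weight of `M` by `x - b i` for each edge of
`M` at buyer `i`. -/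
lemma matchWeight_update {m n : ℕ} (b : Fin m → ℝ) (s : Fin n → ℝ) (i : Fin m) (x : ℝ)
    (M : Finset (Fin m × Fin n)) :
    matchWeight (Function.update b i x) s M =
      matchWeight b s M + (x - b i) * (#{e ∈ M | e.1 = i} : ℝ) := by
  have h : (x - b i) * (#{e ∈ M | e.1 = i} : ℝ) = ∑ e ∈ M, if e.1 = i then x - b i else 0 := by
    rw [← Finset.sum_filter, Finset.sum_const, nsmul_eq_mul, mul_comm]
  rw [h, matchWeight, matchWeight, ← Finset.sum_add_distrib]
  refine Finset.sum_congr rfl fun e _ => ?_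
  by_cases he : e.1 = i
  · simp [he]
  · simp [he]

lemma IsMatching.card_buyer_le_one {m n : ℕ} {M : Finset (Fin m × Fin n)} (hM : IsMatching M)
    (i : Fin m) : #{e ∈ M | e.1 = i} ≤ 1 := by
  refine Finset.card_le_one.2 fun e he e' he' => ?_
  rw [Finset.mem_filter] at he he'
  by_contra hne
  exact (hM e he.1 e' he'.1 hne).1 (he.2.trans he'.2.symm)

/-- Raising the bid of a buyer who is matched does not change the selected matching. -/
lemma MarketSetup.Mstar_update_of_mem {m n : ℕ} (mk : MarketSetup m n) {b : Fin m → ℝ}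
    {s : Fin n → ℝ} {i : Fin m} {j : Fin n} {x : ℝ} (hx : b i ≤ x)
    (hij : (i, j) ∈ mk.Mstar b s) :
    mk.Mstar (Function.update b i x) s = mk.Mstar b s := by
  by_contra hne
  set b' := Function.update b i x with hb'
  have hmem := mk.Mstar_mem b s
  have hmem' := mk.Mstar_mem b' s
  have hcard : (#{e ∈ mk.Mstar b s | e.1 = i} : ℝ) = 1 := by
    refine mod_cast le_antisymm ((mk.matching _ hmem).card_buyer_le_one i) ?_
    exact Finset.card_pos.2 ⟨(i, j), by simp [hij]⟩
  have hcard' : (#{e ∈ mk.Mstar b' s | e.1 = i} : ℝ) ≤ 1 :=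
    mod_cast (mk.matching _ hmem').card_buyer_le_one i
  have hw := matchWeight_update b s i x (mk.Mstar b s)
  have hw' := matchWeight_update b s i x (mk.Mstar b' s)
  rw [← hb'] at hw hw'
  rw [hcard] at hw
  have hmax := mk.Mstar_max b s _ hmem'
  have hmax' := mk.Mstar_max b' s _ hmem
  have hgain := mul_le_mul_of_nonneg_left hcard' (sub_nonneg.2 hx)
  have hlt := mk.Mstar_lt b s _ hmem' (by linarith) hne
  have hlt' := mk.Mstar_lt b' s _ hmem (by linarith) (Ne.symm hne)
  exact mk.tb_irrefl _ hmem (mk.tb_trans _ hmem _ hmem' _ hmem hlt hlt')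

/-- Every selected edge has nonnegative surplus. -/
lemma MarketSetup.le_of_mem_Mstar {m n : ℕ} (mk : MarketSetup m n) {b : Fin m → ℝ}
    {s : Fin n → ℝ} {i : Fin m} {j : Fin n} (hij : (i, j) ∈ mk.Mstar b s) : s j ≤ b i := by
  have h := mk.Mstar_max b s _
    (mk.downward_closed _ (mk.Mstar_mem b s) _ (Finset.erase_subset (i, j) _))
  have hsum := Finset.add_sum_erase (mk.Mstar b s) (fun e => b e.1 - s e.2) hij
  simp only [matchWeight] at h hsum
  linarith

/-- The critical cost is monotone in the buyer's bid. -/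
lemma critCost_update_mono {m n : ℕ} (mk : MarketSetup m n) (i : Fin m) (j : Fin n)
    (b : Fin m → ℝ) (s : Fin n → ℝ) :
    Monotone fun x => critCost mk i j (Function.update b i x) s := by
  intro x y hxy
  refine sSup_le_sSup (Set.image_mono fun t ht => ?_)
  simp only [critSet, Set.mem_ofPred_eq] at ht ⊢
  have h := mk.Mstar_update_of_mem (x := y) (by simpa using hxy) ht
  rw [Function.update_idem] at h
  rwa [h]

/-- Fix a profile `(v,c)` and an edge `(i,j) ∈ M*(v,c)`, and suppose
every edge rule is cap-monotone and buyer-monotone.  For a bid `b` of buyer `i` write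
`κ(b) := c̄_ij((b, v₋ᵢ), c₋ⱼ)`; let `W_BT` be the standalone winning set of buyer bids
(under the cap `κ(vᵢ)`), `W_MA` the Meta-Auction winning set, with infima `p_BT`, `p_MA`
in the extended reals.  If `X^S_{ij}(κ(vᵢ), vᵢ, cⱼ) = 1` (trade occurs), then every bid
`b < p_BT` is not in `W_MA`; hence `p_MA ≥ p_BT`, `p_MA` is real with `cⱼ ≤ κ(vᵢ)` and
`p_MA ≤ vᵢ`, and the seller's realized profit satisfies `p_MA − cⱼ ≥ p_BT − cⱼ`. -/
theorem MAS_profit_dominates_BT {m n : ℕ} (mk : MarketSetup m n)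
    (XS : Fin m × Fin n → BTRule)
    (hXcap : ∀ e ∈ mk.E, CapMonotone (XS e))
    (hXbuy : ∀ e ∈ mk.E, BuyerMonotone (XS e))
    (v : Fin m → ℝ) (c : Fin n → ℝ) (i : Fin m) (j : Fin n)
    (hij : (i, j) ∈ mk.Mstar v c)
    (κ : ℝ → EReal)
    (hκ : ∀ b : ℝ, κ b = critCost mk i j (Function.update v i b) c)
    (WBT WMA : Set ℝ)
    (hWBT : WBT = {b : ℝ | XS (i, j) (κ (v i)) b (c j) = true})
    (hWMA : WMA = {b : ℝ | tradesMAS mk XS (Function.update v i b) c i j})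
    (pBT pMA : EReal)
    (hpBT : pBT = sInf ((fun x : ℝ => (x : EReal)) '' WBT))
    (hpMA : pMA = sInf ((fun x : ℝ => (x : EReal)) '' WMA))
    (htrade : XS (i, j) (κ (v i)) (v i) (c j) = true) :
    (∀ b : ℝ, (b : EReal) < pBT → b ∉ WMA) ∧
    pBT ≤ pMA ∧
    (pMA ≠ ⊤ ∧ pMA ≠ ⊥) ∧
    (c j : EReal) ≤ κ (v i) ∧
    pMA ≤ (v i : EReal) ∧
    pBT - (c j : EReal) ≤ pMA - (c j : EReal) := by
  have hE : (i, j) ∈ mk.E := mk.subset_E _ (mk.Mstar_mem v c) hij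
  have hvBT : v i ∈ WBT := by rw [hWBT]; exact htrade
  have hvMA : v i ∈ WMA := by
    rw [hWMA]
    refine ⟨by simpa using hij, ?_⟩
    rw [← hκ]
    simpa using htrade
  have hBT : ∀ b ∈ WBT, pBT ≤ (b : EReal) := fun b hb =>
    hpBT ▸ sInf_le (Set.mem_image_of_mem _ hb)
  have hMA : ∀ b ∈ WMA, pBT ≤ (b : EReal) ∧ c j ≤ b := by
    intro b hb
    rw [hWMA] at hb
    obtain ⟨hmem, hX⟩ := hb
    refine ⟨?_, by simpa using mk.le_of_mem_Mstar hmem⟩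
    rcases le_total b (v i) with hbv | hbv
    · refine hBT b ?_
      rw [hWBT]
      rw [← hκ, Function.update_self] at hX
      refine hXcap _ hE _ _ _ _ ?_ hX
      rw [hκ, hκ]
      exact critCost_update_mono mk i j v c hbv
    · exact (hBT _ hvBT).trans (EReal.coe_le_coe_iff.2 hbv)
  have hle : pBT ≤ pMA := by
    rw [hpMA]
    exact le_sInf (by rintro _ ⟨b, hb, rfl⟩; exact (hMA b hb).1)
  have hcost : (c j : EReal) ≤ pMA := by
    rw [hpMA]
    exact le_sInf (by rintro _ ⟨b, hb, rfl⟩; exact EReal.coe_le_coe_iff.2 (hMA b hb).2)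
  have hpv : pMA ≤ (v i : EReal) := hpMA ▸ sInf_le (Set.mem_image_of_mem _ hvMA)
  refine ⟨fun b hb hbW => hb.not_ge (hMA b hbW).1, hle,
    ⟨(hpv.trans_lt (EReal.coe_lt_top _)).ne, ((EReal.bot_lt_coe _).trans_le hcost).ne'⟩, ?_, hpv,
    EReal.sub_le_sub hle le_rfl⟩
  rw [hκ]
  exact le_sSup (Set.mem_image_of_mem _ (by simpa [critSet] using hij))
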